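/- arXiv:2207.06380 — 4 statements merged into one kernel-verified Lean document; each statement's English description precedes it below -/
import Mathlib

section
/- Let 𝕜 be an algebraically closed field of characteristic p > 0, R = 𝕜[x_1,…,x_n], I = (f_1,…,f_r) an ideal of height c, S = R[u_{ij} : 1 ≤ i ≤ c, 1 ≤ j ≤ r], g_i := u_{i1}f_1 + ⋯ + u_{ir}f_r, L := (g_1,…,g_c) ⊆ S, and J := (L :_S IS) the generic linkage of I. Then lce_R(I^c) = lce_S(L^c) ≤ lce_S(J^c). -/
open Ideal MvPolynomial

set_option synthInstance.maxHeartbeats 1000000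
set_option maxHeartbeats 1000000

/-- The Frobenius `q`-th power of an ideal: the ideal generated by `q`-th powers of elements. -/
def Ideal.frobPow {A : Type*} [CommRing A] (q : ℕ) (I : Ideal A) : Ideal A :=
  Ideal.span ((fun h => h ^ q) '' (I : Set A))

/-- The bracket power `I^{[b]}` with respect to the base-`p` expansion of `b`. -/
def Ideal.bracketPow {A : Type*} [CommRing A] (p : ℕ) (I : Ideal A) (b : ℕ) : Ideal A :=
  ∏ i ∈ Finset.range (Nat.digits p b).length,
    Ideal.frobPow (p ^ i) (I ^ ((Nat.digits p b).getD i 0))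

/-- The least critical exponent of an ideal. -/
noncomputable def Ideal.lce {A : Type*} [CommRing A] (p : ℕ) (I : Ideal A) : ℝ :=
  sSup {t : ℝ | ∃ b e : ℕ, t = (b : ℝ) / (p : ℝ) ^ e ∧
    ∀ m : Ideal A, m.IsMaximal → ¬ (I.bracketPow p b ≤ m.frobPow (p ^ e))}

/-- The F-pure threshold of an ideal. -/
noncomputable def Ideal.fpt {A : Type*} [CommRing A] (p : ℕ) (I : Ideal A) : ℝ :=
  sSup {t : ℝ | ∃ a e : ℕ, t = (a : ℝ) / (p : ℝ) ^ e ∧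
    ∀ m : Ideal A, m.IsMaximal → ¬ (I ^ a ≤ m.frobPow (p ^ e))}

/-- The height of an ideal: the infimum of heights of primes containing it. -/
noncomputable def Ideal.idealHeight {A : Type*} [CommRing A] (I : Ideal A) : ℕ∞ :=
  ⨅ p : {p : PrimeSpectrum A // I ≤ p.asIdeal}, Order.height p.1

/-- Induction along base-`p` expansions. -/
theorem Nat.digit_induction {p : ℕ} (hp : 1 < p) {P : ℕ → Prop} (zero : P 0)
    (add_mul : ∀ a b, a < p → P b → P (a + p * b)) (n : ℕ) : P n := by
  induction n using Nat.strong_induction_on with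
  | _ n ih =>
    rcases Nat.eq_zero_or_pos n with rfl | hn
    · exact zero
    · rw [← Nat.mod_add_div n p]
      exact add_mul _ _ (Nat.mod_lt _ (by lia)) (ih _ (Nat.div_lt_self hn hp))

namespace Ideal

section FrobPow

variable {A : Type*} [CommRing A] {q : ℕ}

theorem frobPow_mono {I J : Ideal A} (h : I ≤ J) : I.frobPow q ≤ J.frobPow q :=
  span_mono (Set.image_mono h)

theorem frobPow_le_self (hq : q ≠ 0) (I : Ideal A) : I.frobPow q ≤ I := by
  rw [frobPow, span_le]
  rintro _ ⟨h, hh, rfl⟩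
  exact I.pow_mem_of_mem hh q (Nat.pos_of_ne_zero hq)

theorem pow_mem_frobPow {I : Ideal A} {h : A} (hh : h ∈ I) : h ^ q ∈ I.frobPow q :=
  subset_span ⟨h, hh, rfl⟩

@[simp]
theorem bracketPow_zero (p : ℕ) (I : Ideal A) : I.bracketPow p 0 = ⊤ := by
  simp [bracketPow]

end FrobPow

section CharP

variable {A B : Type*} [CommRing A] [CommRing B] {p : ℕ} [hp : Fact p.Prime] [CharP A p] [CharP B p]

theorem frobPow_eq_map (e : ℕ) (I : Ideal A) :
    I.frobPow (p ^ e) = I.map (iterateFrobenius A p e) := rfl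

theorem frobPow_self_eq_map (I : Ideal A) : I.frobPow p = I.map (frobenius A p) := rfl

theorem frobPow_pow_succ (e : ℕ) (I : Ideal A) :
    I.frobPow (p ^ (e + 1)) = (I.frobPow (p ^ e)).frobPow p := by
  rw [frobPow_eq_map, frobPow_eq_map, frobPow_self_eq_map, map_map, add_comm,
    iterateFrobenius_add, iterateFrobenius_one]

theorem map_frobPow (φ : A →+* B) (e : ℕ) (I : Ideal A) :
    (I.frobPow (p ^ e)).map φ = (I.map φ).frobPow (p ^ e) := by
  rw [frobPow_eq_map, frobPow_eq_map, map_map, map_map]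
  congr 1
  ext x
  simp [iterateFrobenius_def]

/-- Removing the lowest base-`p` digit of the exponent of a bracket power. -/
theorem bracketPow_add_mul (I : Ideal A) {a : ℕ} (ha : a < p) (b : ℕ) :
    I.bracketPow p (a + p * b) = I ^ a * (I.bracketPow p b).frobPow p := by
  by_cases h : a ≠ 0 ∨ b ≠ 0
  · rw [bracketPow, Nat.digits_add p hp.out.one_lt a b ha h, List.length_cons,
      Finset.prod_range_succ', mul_comm]
    congr 1
    · simp [frobPow]
    · rw [bracketPow, frobPow_self_eq_map, ← mapHom_apply, map_prod]
      refine Finset.prod_congr rfl fun i _ => ?_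
      rw [frobPow_pow_succ, List.getD_cons_succ, frobPow_self_eq_map, mapHom_apply]
  · push Not at h
    obtain ⟨rfl, rfl⟩ := h
    simp [frobPow_self_eq_map, map_top]

theorem bracketPow_mono {I J : Ideal A} (h : I ≤ J) (b : ℕ) :
    I.bracketPow p b ≤ J.bracketPow p b := by
  induction b using Nat.digit_induction hp.out.one_lt with
  | zero => simp
  | add_mul a b ha ih =>
    rw [bracketPow_add_mul _ ha, bracketPow_add_mul _ ha]
    exact mul_mono (pow_right_mono h a) (frobPow_mono ih)

@[simp]
theorem top_bracketPow (b : ℕ) : (⊤ : Ideal A).bracketPow p b = ⊤ := by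
  induction b using Nat.digit_induction hp.out.one_lt with
  | zero => simp
  | add_mul a b ha ih =>
    rw [bracketPow_add_mul _ ha, ih, frobPow_self_eq_map, map_top, ← one_eq_top, one_pow, one_mul]

theorem map_bracketPow (φ : A →+* B) (I : Ideal A) (b : ℕ) :
    (I.bracketPow p b).map φ = (I.map φ).bracketPow p b := by
  induction b using Nat.digit_induction hp.out.one_lt with
  | zero => simp [map_top]
  | add_mul a b ha ih =>
    have := map_frobPow (p := p) φ 1 (I.bracketPow p b)
    rw [pow_one] at this
    rw [bracketPow_add_mul _ ha, bracketPow_add_mul _ ha, Ideal.map_mul, Ideal.map_pow, this, ih]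

theorem pow_bracketPow (I : Ideal A) (c b : ℕ) :
    (I ^ c).bracketPow p b = I.bracketPow p b ^ c := by
  induction b using Nat.digit_induction hp.out.one_lt with
  | zero => simp [← one_eq_top]
  | add_mul a b ha ih =>
    rw [bracketPow_add_mul _ ha, bracketPow_add_mul _ ha, ih, mul_pow, frobPow_self_eq_map,
      frobPow_self_eq_map, Ideal.map_pow, ← pow_mul, ← pow_mul, mul_comm c]

theorem pow_mem_bracketPow {I : Ideal A} {x : A} (hx : x ∈ I) (b : ℕ) :
    x ^ b ∈ I.bracketPow p b := by
  induction b using Nat.digit_induction hp.out.one_lt with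
  | zero => simp
  | add_mul a b ha ih =>
    rw [bracketPow_add_mul _ ha, pow_add, mul_comm p, pow_mul]
    exact mul_mem_mul (pow_mem_pow hx a) (pow_mem_frobPow ih)

theorem bracketPow_le_self (I : Ideal A) {b : ℕ} (hb : b ≠ 0) : I.bracketPow p b ≤ I := by
  induction b using Nat.digit_induction hp.out.one_lt with
  | zero => exact absurd rfl hb
  | add_mul a b ha ih =>
    rw [bracketPow_add_mul _ ha]
    by_cases h : a = 0
    · have hb : b ≠ 0 := by rintro rfl; simp [h] at hb
      exact mul_le_right.trans ((frobPow_le_self hp.out.ne_zero _).trans (ih hb))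
    · exact mul_le_left.trans (pow_le_self h)

theorem bracketPow_le_frobPow (I : Ideal A) {b e : ℕ} (h : p ^ e ≤ b) :
    I.bracketPow p b ≤ I.frobPow (p ^ e) := by
  induction e generalizing b with
  | zero => simpa [frobPow, span_eq] using I.bracketPow_le_self (p := p) (b := b) (by simp at h; lia)
  | succ e ih =>
    rw [← Nat.mod_add_div b p, bracketPow_add_mul _ (Nat.mod_lt _ hp.out.pos), frobPow_pow_succ]
    refine mul_le_right.trans (frobPow_mono (ih ?_))
    rwa [Nat.le_div_iff_mul_le hp.out.pos, ← pow_succ]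

theorem lce_le_lce {I J : Ideal A} (hIJ : I ≤ J) (hJ : J ≠ ⊤) : lce p I ≤ lce p J := by
  obtain ⟨m, hm, hJm⟩ := J.exists_le_maximal hJ
  refine csSup_le_csSup ⟨1, ?_⟩ ⟨0, 0, 0, by simp, fun m hm h => ?_⟩ ?_
  · rintro _ ⟨b, e, rfl, h⟩
    rw [div_le_one (by have := hp.out.pos; positivity)]
    by_contra! hlt
    refine h m hm ((bracketPow_le_frobPow J ?_).trans (frobPow_mono hJm))
    exact_mod_cast hlt.le
  · rw [bracketPow_zero, top_le_iff] at h
    exact hm.ne_top (top_le_iff.1 (h ▸ frobPow_le_self (by simp) m))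
  · rintro _ ⟨b, e, rfl, h⟩
    exact ⟨b, e, rfl, fun m hm hle => h m hm ((bracketPow_mono hIJ b).trans hle)⟩

end CharP

end Ideal

section Multinomial

open Finset

theorem Nat.factorization_factorial_add_mul {p : ℕ} [hp : Fact p.Prime] {a : ℕ} (ha : a < p)
    (b : ℕ) : (Nat.factorial (a + p * b)).factorization p = b + b.factorial.factorization p := by
  rw [Nat.factorization_def _ hp.out, Nat.factorization_def _ hp.out, add_comm a,
    padicValNat_factorial_mul_add _ ha, padicValNat_factorial_mul, add_comm]

theorem Nat.not_dvd_multinomial_add_mul {ι : Type*} {p : ℕ} [hp : Fact p.Prime] (s : Finset ι)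
    (a b : ι → ℕ) (ha : ∑ i ∈ s, a i < p) (hb : ¬ p ∣ Nat.multinomial s b) :
    ¬ p ∣ Nat.multinomial s (a + p • b) := by
  have key (d : ι → ℕ) : ∑ i ∈ s, (d i).factorial.factorization p +
      (Nat.multinomial s d).factorization p = (∑ i ∈ s, d i).factorial.factorization p := by
    rw [← Nat.multinomial_spec, Nat.factorization_mul
      (prod_ne_zero_iff.2 fun i _ => Nat.factorial_ne_zero _) (Nat.multinomial_pos s d).ne',
      Nat.factorization_prod fun i _ => Nat.factorial_ne_zero _]
    simp
  have h₁ := key b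
  have h₂ := key (a + p • b)
  have hsum : ∑ i ∈ s, (a + p • b) i = ∑ i ∈ s, a i + p * ∑ i ∈ s, b i := by
    simp [sum_add_distrib, mul_sum]
  rw [hsum, Nat.factorization_factorial_add_mul ha, sum_congr rfl fun i hi => by
    rw [Pi.add_apply, Pi.smul_apply, smul_eq_mul, Nat.factorization_factorial_add_mul
      ((single_le_sum (fun _ _ => Nat.zero_le _) hi).trans_lt ha)], sum_add_distrib] at h₂
  rw [Nat.factorization_eq_zero_of_not_dvd hb] at h₁
  intro hdvd
  have := (hp.out.dvd_iff_one_le_factorization (Nat.multinomial_pos s (a + p • b)).ne').1 hdvd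
  lia

end Multinomial

namespace Ideal

variable {A ι : Type*} [CommRing A] [Fintype ι]

theorem span_range_pow_le (f : ι → A) (a : ℕ) :
    span (Set.range f) ^ a ≤ span {x | ∃ α : ι → ℕ, ∑ j, α j = a ∧ ∏ j, f j ^ α j = x} := by
  classical
  induction a with
  | zero => simp [show ∃ α : ι → ℕ, (∀ j, α j = 0) ∧ ∏ j, f j ^ α j = 1 from ⟨0, by simp⟩,
      (eq_top_iff_one _).2 (subset_span _)]
  | succ a ih =>
    rw [pow_succ]
    refine (mul_mono_left ih).trans ?_
    rw [span_mul_span', span_le]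
    rintro _ ⟨_, ⟨α, rfl, rfl⟩, _, ⟨j, rfl⟩, rfl⟩
    exact subset_span ⟨α + Pi.single j 1, by simp [Finset.sum_add_distrib],
      by simp only [Pi.add_apply, pow_add, Finset.prod_mul_distrib]; simp [Pi.single_apply]⟩

theorem bracketPow_span_range_le {p : ℕ} [hp : Fact p.Prime] [CharP A p] (f : ι → A) (b : ℕ) :
    (span (Set.range f)).bracketPow p b ≤ span {x | ∃ α : ι → ℕ,
      (∑ j, α j = b ∧ ¬ p ∣ Nat.multinomial Finset.univ α) ∧ ∏ j, f j ^ α j = x} := by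
  induction b using Nat.digit_induction hp.out.one_lt with
  | zero =>
    rw [bracketPow_zero, top_le_iff, eq_top_iff_one]
    exact subset_span ⟨0, by simp [Nat.multinomial, hp.out.ne_one], by simp⟩
  | add_mul a b ha ih =>
    rw [bracketPow_add_mul _ ha]
    refine (mul_mono (span_range_pow_le f a) (frobPow_mono ih)).trans ?_
    rw [frobPow_self_eq_map, map_span, span_mul_span', span_le]
    rintro _ ⟨_, ⟨α, rfl, rfl⟩, _, ⟨_, ⟨β, ⟨rfl, hβ⟩, rfl⟩, rfl⟩, rfl⟩
    refine subset_span ⟨α + p • β, ⟨by simp [Finset.sum_add_distrib, Finset.mul_sum],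
      Nat.not_dvd_multinomial_add_mul _ _ _ ha hβ⟩, ?_⟩
    simp [frobenius_def, pow_add, Finset.prod_mul_distrib, pow_mul', Finset.prod_pow]

end Ideal

namespace MvPolynomial

section Reduction

variable {σ R : Type*} [Fintype σ] [CommRing R]

/-- The `R`-linear reduction of polynomials modulo the relations `X k ^ q = w k`. -/
noncomputable def reducePow (q : ℕ) (w : σ → R) : MvPolynomial σ R →ₗ[R] MvPolynomial σ R :=
  (basisMonomials σ R).constr R fun β =>
    monomial (β.mapRange (· % q) (Nat.zero_mod q)) (∏ k, w k ^ (β k / q))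

theorem reducePow_monomial (q : ℕ) (w : σ → R) (β : σ →₀ ℕ) (a : R) :
    reducePow q w (monomial β a) =
      monomial (β.mapRange (· % q) (Nat.zero_mod q)) (a * ∏ k, w k ^ (β k / q)) := by
  have h : reducePow q w (monomial β 1) =
      monomial (β.mapRange (· % q) (Nat.zero_mod q)) (∏ k, w k ^ (β k / q)) := by
    simpa [reducePow] using (basisMonomials σ R).constr_basis R (fun β =>
      monomial (β.mapRange (· % q) (Nat.zero_mod q)) (∏ k, w k ^ (β k / q))) β
  rw [← mul_one a, ← smul_eq_mul, ← smul_monomial, map_smul, h, smul_monomial]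
  simp

theorem reducePow_eq_self {q : ℕ} (w : σ → R) {P : MvPolynomial σ R}
    (hP : ∀ β ∈ P.support, ∀ k, β k < q) : reducePow q w P = P := by
  conv_lhs => rw [P.as_sum, map_sum]
  conv_rhs => rw [P.as_sum]
  refine Finset.sum_congr rfl fun β hβ => ?_
  rw [reducePow_monomial]
  congr 1
  · refine congrArg _ (Finsupp.ext fun k => ?_)
    simp [Nat.mod_eq_of_lt (hP β hβ k)]
  · simp [Nat.div_eq_of_lt (hP β hβ _)]

theorem reducePow_mem_map_C {q : ℕ} (w : σ → R) {Q : Ideal R} {P : MvPolynomial σ R}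
    (hP : P ∈ Q.map (C : R →+* MvPolynomial σ R)) :
    reducePow q w P ∈ Q.map (C : R →+* MvPolynomial σ R) := by
  rw [P.as_sum, map_sum]
  refine Ideal.sum_mem _ fun β _ => ?_
  rw [reducePow_monomial, ← C_mul_monomial]
  exact Ideal.mul_mem_right _ _ (Ideal.mem_map_of_mem _ (mem_map_C_iff.1 hP β))

theorem reducePow_X_pow_sub_mul {q : ℕ} (hq : 0 < q) (w : σ → R) (k : σ) (P : MvPolynomial σ R) :
    reducePow q w ((X k ^ q - C (w k)) * P) = 0 := by
  classical
  induction P using MvPolynomial.induction_on' with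
  | add P Q hP hQ => rw [mul_add, map_add, hP, hQ, add_zero]
  | monomial β a =>
    rw [sub_mul, map_sub, sub_eq_zero, X_pow_eq_monomial, monomial_mul, C_mul_monomial,
      reducePow_monomial, reducePow_monomial]
    congr 1
    · refine congrArg _ (Finsupp.ext fun j => ?_)
      by_cases h : k = j <;> simp [h]
    · have : ∏ j, w j ^ ((Finsupp.single k q + β) j / q) = w k * ∏ j, w j ^ (β j / q) := by
        rw [← Fintype.prod_ite_eq k w, ← Finset.prod_mul_distrib]
        refine Finset.prod_congr rfl fun j _ => ?_
        by_cases h : k = j <;> simp [h, hq, Nat.add_div_left, pow_succ']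
      rw [this]; ring

/-- Polynomials of degree less than `q` in every variable are in normal form modulo the relations
`X k ^ q = w k`. -/
theorem mem_map_C_of_mem_sup {q : ℕ} (hq : 0 < q) (w : σ → R) {Q : Ideal R} {P : MvPolynomial σ R}
    (hdeg : ∀ β ∈ P.support, ∀ k, β k < q)
    (hP : P ∈ Q.map (C : R →+* MvPolynomial σ R) ⊔
      Ideal.span (Set.range fun k => X k ^ q - C (w k))) :
    P ∈ Q.map (C : R →+* MvPolynomial σ R) := by
  obtain ⟨P₁, h₁, P₂, h₂, rfl⟩ := Submodule.mem_sup.1 hP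
  have h₃ : reducePow q w P₂ = 0 := by
    obtain ⟨s, rfl⟩ := (Ideal.mem_span_range_iff_exists_fun).1 h₂
    rw [map_sum]
    exact Finset.sum_eq_zero fun k _ => by rw [mul_comm, reducePow_X_pow_sub_mul hq]
  rw [← reducePow_eq_self w hdeg, map_add, h₃, add_zero]
  exact reducePow_mem_map_C w h₁

end Reduction

end MvPolynomial

section Nullstellensatz

variable {𝕜 σ τ : Type*} [Field 𝕜] [IsAlgClosed 𝕜] [Finite σ] [Finite τ]

theorem MvPolynomial.exists_sub_C_C_mem (M : Ideal (MvPolynomial τ (MvPolynomial σ 𝕜)))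
    [M.IsMaximal] (s : MvPolynomial τ (MvPolynomial σ 𝕜)) : ∃ a : 𝕜, s - C (C a) ∈ M := by
  let := Ideal.Quotient.field M
  have : Algebra.FiniteType 𝕜 (MvPolynomial τ (MvPolynomial σ 𝕜)) :=
    Algebra.FiniteType.trans (S := MvPolynomial σ 𝕜) inferInstance inferInstance
  have : Module.Finite 𝕜 (MvPolynomial τ (MvPolynomial σ 𝕜) ⧸ M) :=
    finite_of_finite_type_of_isJacobsonRing _ _
  obtain ⟨a, ha⟩ := (IsAlgClosed.algebraMap_bijective_of_isIntegral (k := 𝕜)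
    (K := MvPolynomial τ (MvPolynomial σ 𝕜) ⧸ M)).2 (Ideal.Quotient.mk M s)
  exact ⟨a, Ideal.Quotient.eq.1 ha.symm⟩

theorem MvPolynomial.isMaximal_comap_C (M : Ideal (MvPolynomial τ (MvPolynomial σ 𝕜)))
    [M.IsMaximal] : (M.comap (C : MvPolynomial σ 𝕜 →+* _)).IsMaximal := by
  let := Ideal.Quotient.field M
  rw [← Ideal.mk_ker (I := M), RingHom.comap_ker]
  refine RingHom.ker_isMaximal_of_surjective _ fun y => ?_
  obtain ⟨s, rfl⟩ := Ideal.Quotient.mk_surjective y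
  obtain ⟨a, ha⟩ := exists_sub_C_C_mem M s
  exact ⟨C a, (Ideal.Quotient.eq.2 ha).symm⟩

end Nullstellensatz

namespace MvPolynomial

section Frobenius

variable {R τ : Type*} [CommRing R] {p : ℕ} [hp : Fact p.Prime] [CharP R p]

theorem frobPow_le_of_X_sub_C_mem {M : Ideal (MvPolynomial τ R)} (v : τ → R)
    (hv : ∀ k, X k - C (v k) ∈ M) (e : ℕ) :
    M.frobPow (p ^ e) ≤ ((M.comap C).frobPow (p ^ e)).map (C : R →+* MvPolynomial τ R) ⊔
      Ideal.span (Set.range fun k => X k ^ p ^ e - C (v k ^ p ^ e)) := by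
  set N : Ideal (MvPolynomial τ R) :=
    (M.comap C).map C ⊔ Ideal.span (Set.range fun k => X k - C (v k))
  have hsub (s : MvPolynomial τ R) : s - C (eval v s) ∈
      Ideal.span (Set.range fun k => X k - C (v k)) := by
    induction s using MvPolynomial.induction_on with
    | C a => simp
    | add s t hs ht =>
      rw [map_add, map_add, add_sub_add_comm]
      exact add_mem hs ht
    | mul_X s k hs =>
      have h : s * X k - C (eval v (s * X k)) =
          (s - C (eval v s)) * X k + C (eval v s) * (X k - C (v k)) := by
        simp; ring
      rw [h]
      exact add_mem (Ideal.mul_mem_right _ _ hs)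
        (Ideal.mul_mem_left _ _ (Ideal.subset_span ⟨k, rfl⟩))
  have hN : M ≤ N := fun s hs => by
    have hsM : s - C (eval v s) ∈ M :=
      (Ideal.span_le.2 (by rintro _ ⟨k, rfl⟩; exact hv k)) (hsub s)
    have hC : C (eval v s) ∈ M := by simpa using sub_mem hs hsM
    rw [← add_sub_cancel (C (eval v s)) s]
    exact Submodule.add_mem_sup (Ideal.mem_map_of_mem _ hC) (hsub s)
  refine (Ideal.frobPow_mono hN).trans_eq ?_
  rw [Ideal.frobPow_eq_map, Ideal.map_sup, ← Ideal.frobPow_eq_map, ← Ideal.map_frobPow,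
    Ideal.map_span, ← Set.range_comp]
  congr 3
  ext k
  simp [iterateFrobenius_def, sub_pow_char_pow]

end Frobenius

section GenericProduct

variable {R κ ι : Type*} [CommRing R] [Fintype κ] [Fintype ι]

theorem prod_generic_pow (f : ι → R) (b : ℕ) [DecidableEq κ] [DecidableEq ι] :
    (∏ k : κ, ∑ j, X (k, j) * C (f j) : MvPolynomial (κ × ι) R) ^ b =
      ∑ α ∈ Fintype.piFinset fun _ : κ => Finset.piAntidiag (Finset.univ : Finset ι) b,
        monomial (Finsupp.equivFunOnFinite.symm fun x => α x.1 x.2)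
          (∏ k, ((Nat.multinomial Finset.univ (α k) : R) * ∏ j, f j ^ α k j)) := by
  simp_rw [← Finset.prod_pow, Finset.sum_pow_eq_sum_piAntidiag, Finset.prod_univ_sum]
  refine Finset.sum_congr rfl fun α _ => ?_
  rw [monomial_eq, Finsupp.prod_fintype _ _ (by simp)]
  simp only [Finsupp.equivFunOnFinite_symm_apply_apply, Fintype.prod_prod_type, mul_pow,
    Finset.prod_mul_distrib, map_mul, map_prod, map_pow, map_natCast]
  ring

theorem coeff_prod_generic_pow (f : ι → R) (b : ℕ) (α : κ → ι → ℕ) (hα : ∀ k, ∑ j, α k j = b) :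
    coeff (Finsupp.equivFunOnFinite.symm fun x => α x.1 x.2)
      ((∏ k : κ, ∑ j, X (k, j) * C (f j) : MvPolynomial (κ × ι) R) ^ b) =
      ∏ k, ((Nat.multinomial Finset.univ (α k) : R) * ∏ j, f j ^ α k j) := by
  classical
  rw [prod_generic_pow, coeff_sum, Finset.sum_eq_single α]
  · simp
  · intro β _ hβ
    rw [coeff_monomial, if_neg]
    intro h
    refine hβ (funext₂ fun k j => ?_)
    exact congrFun (Finsupp.equivFunOnFinite.symm.injective h) (k, j)
  · intro h
    exact absurd (by simpa using hα) h

theorem le_of_mem_support_prod_generic_pow (f : ι → R) (b : ℕ) {β : κ × ι →₀ ℕ}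
    (hβ : β ∈ ((∏ k : κ, ∑ j, X (k, j) * C (f j) : MvPolynomial (κ × ι) R) ^ b).support)
    (x : κ × ι) : β x ≤ b := by
  classical
  rw [prod_generic_pow] at hβ
  obtain ⟨α, hα, hβ⟩ := Finset.mem_biUnion.1 (support_sum hβ)
  obtain rfl := Finset.mem_singleton.1 (support_monomial_subset hβ)
  have h : ∑ j, α x.1 j = b := by simpa using Fintype.mem_piFinset.1 hα x.1
  rw [← h]
  exact Finset.single_le_sum (f := α x.1) (fun _ _ => Nat.zero_le _) (Finset.mem_univ x.2)

end GenericProduct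

end MvPolynomial

section GenericLinkage

variable {𝕜 R κ ι σ : Type*} [Field 𝕜] [CommRing R] [Algebra 𝕜 R] [Fintype κ] [Fintype ι]
  {p : ℕ} [hp : Fact p.Prime]

/-- The coefficients of the `b`-th power of a product of generic combinations of `f` generate
the bracket power. -/
theorem Ideal.bracketPow_le_of_prod_generic_pow_mem [CharP 𝕜 p] [CharP R p] (f : ι → R) (b : ℕ)
    {Q : Ideal R}
    (h : (∏ k : κ, ∑ j, X (k, j) * C (f j) : MvPolynomial (κ × ι) R) ^ b ∈
      Q.map (C : R →+* MvPolynomial (κ × ι) R)) :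
    (Ideal.span (Set.range f) ^ Fintype.card κ).bracketPow p b ≤ Q := by
  rw [Ideal.pow_bracketPow]
  refine (Ideal.pow_right_mono (Ideal.bracketPow_span_range_le f b) _).trans ?_
  rw [← Finset.card_univ, ← Finset.prod_const, Ideal.prod_span, Ideal.span_le]
  intro x hx
  obtain ⟨y, hy, rfl⟩ := (Set.mem_fintype_prod _ _).1 hx
  choose α hα hα' using hy
  have hmem := MvPolynomial.mem_map_C_iff.1 h (Finsupp.equivFunOnFinite.symm fun x : κ × ι => α x.1 x.2)
  rw [coeff_prod_generic_pow f b α fun k => (hα k).1, Finset.prod_mul_distrib,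
    Finset.prod_congr rfl fun k _ => hα' k] at hmem
  refine (Ideal.unit_mul_mem_iff_mem Q ?_).1 hmem
  rw [← Nat.cast_prod, ← map_natCast (algebraMap 𝕜 R)]
  refine RingHom.isUnit_map _ (isUnit_iff_ne_zero.2 ?_)
  rw [Nat.cast_prod, Finset.prod_ne_zero_iff]
  exact fun k _ => mt (CharP.cast_eq_zero_iff 𝕜 p _).1 (hα k).2

theorem Ideal.lce_pow_generic [IsAlgClosed 𝕜] [CharP 𝕜 p] [Finite σ] [Nonempty κ]
    (f : ι → MvPolynomial σ 𝕜) (hI : Ideal.span (Set.range f) ≠ ⊤) :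
    Ideal.lce p (Ideal.span (Set.range f) ^ Fintype.card κ) =
      Ideal.lce p (Ideal.span (Set.range fun k : κ =>
        (∑ j, X (k, j) * C (f j) : MvPolynomial (κ × ι) (MvPolynomial σ 𝕜))) ^ Fintype.card κ) := by
  set I := Ideal.span (Set.range f)
  set G : κ → MvPolynomial (κ × ι) (MvPolynomial σ 𝕜) := fun k => ∑ j, X (k, j) * C (f j)
  have hLI : Ideal.span (Set.range G) ≤ I.map C := by
    rw [Ideal.span_le]
    rintro _ ⟨k, rfl⟩
    exact Ideal.sum_mem _ fun j _ => Ideal.mul_mem_left _ _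
      (Ideal.mem_map_of_mem _ (Ideal.subset_span ⟨j, rfl⟩))
  rw [Ideal.lce, Ideal.lce]
  congr 1
  ext t
  refine exists₂_congr fun b e => and_congr_right fun _ => ⟨fun h M hM hle => ?_,
    fun h m hm hle => ?_⟩
  · have hb : b < p ^ e := by
      by_contra! hbe
      obtain ⟨m, hm, hIm⟩ := I.exists_le_maximal hI
      exact h m hm ((Ideal.bracketPow_le_frobPow _ hbe).trans
        (Ideal.frobPow_mono ((Ideal.pow_le_self Fintype.card_ne_zero).trans hIm)))
    choose v hv using fun x => exists_sub_C_C_mem M (X x)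
    refine h _ (isMaximal_comap_C M) (Ideal.bracketPow_le_of_prod_generic_pow_mem (𝕜 := 𝕜) f b ?_)
    refine mem_map_C_of_mem_sup (pow_pos hp.out.pos e) _ (fun β hβ x =>
      (le_of_mem_support_prod_generic_pow f b hβ x).trans_lt hb)
      (frobPow_le_of_X_sub_C_mem _ hv e (hle (Ideal.pow_mem_bracketPow ?_ b)))
    rw [← Finset.card_univ, ← Finset.prod_const]
    exact Ideal.prod_mem_prod fun k _ => Ideal.subset_span ⟨k, rfl⟩
  · have hmC : m.map (C : _ →+* MvPolynomial (κ × ι) (MvPolynomial σ 𝕜)) ≠ ⊤ := fun htop =>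
      hm.ne_top ((Ideal.eq_top_iff_one _).2 (by
        simpa using MvPolynomial.mem_map_C_iff.1 ((Ideal.eq_top_iff_one _).1 htop) 0))
    obtain ⟨M, hM, hmM⟩ := Ideal.exists_le_maximal _ hmC
    refine h M hM ((Ideal.bracketPow_mono (Ideal.pow_right_mono hLI _) b).trans ?_)
    rw [← Ideal.map_pow, ← Ideal.map_bracketPow]
    refine (Ideal.map_mono hle).trans ?_
    rw [Ideal.map_frobPow]
    exact Ideal.frobPow_mono hmM

end GenericLinkage

theorem Ideal.idealHeight_top {A : Type*} [CommRing A] : (⊤ : Ideal A).idealHeight = ⊤ :=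
  iInf_eq_top.2 fun P => absurd (top_le_iff.1 P.2) P.1.2.ne_top

theorem Ideal.idealHeight_bot {A : Type*} [CommRing A] [IsDomain A] :
    (⊥ : Ideal A).idealHeight = 0 := by
  refine le_antisymm ?_ bot_le
  rw [← Order.height_bot (PrimeSpectrum A)]
  exact iInf_le (fun P : {P : PrimeSpectrum A // ⊥ ≤ P.asIdeal} => Order.height P.1) ⟨⊥, bot_le⟩

theorem Ideal.lce_top {A : Type*} [CommRing A] [Nontrivial A] (p : ℕ) [hp : Fact p.Prime]
    [CharP A p] : Ideal.lce p (⊤ : Ideal A) = sSup {t : ℝ | ∃ b e : ℕ, t = b / (p : ℝ) ^ e} := by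
  rw [Ideal.lce]
  congr 1
  ext t
  refine exists₂_congr fun b e => and_iff_left fun m hm h => hm.ne_top ?_
  rw [top_bracketPow] at h
  exact top_le_iff.1 (h.trans (frobPow_le_self (pow_ne_zero e hp.out.ne_zero) m))

/-- **Proposition (lce and generic linkage).**
Let `𝕜` be an algebraically closed field of characteristic `p > 0`,
`R = 𝕜[x_1,…,x_n]`, `I = (f_1,…,f_r)` an ideal of height `c`,
`S = R[u_{ij}]`, `g i = ∑ j, u_{ij} f_j`, `L = (g_1,…,g_c)` and
`J = (L : IS)` the generic linkage of `I`.  Then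
`lce_R(I^c) = lce_S(L^c) ≤ lce_S(J^c)`. -/
theorem lce_generic_linkage
    {𝕜 : Type*} [Field 𝕜] [IsAlgClosed 𝕜] {p : ℕ} [Fact p.Prime] [CharP 𝕜 p]
    (n r c : ℕ) (f : Fin r → MvPolynomial (Fin n) 𝕜)
    (I : Ideal (MvPolynomial (Fin n) 𝕜)) (hI : I = Ideal.span (Set.range f))
    (hht : I.idealHeight = (c : ℕ∞))
    (g : Fin c → MvPolynomial (Fin c × Fin r) (MvPolynomial (Fin n) 𝕜))
    (hg : ∀ i, g i = ∑ j : Fin r, X (i, j) * C (f j))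
    (L J : Ideal (MvPolynomial (Fin c × Fin r) (MvPolynomial (Fin n) 𝕜)))
    (hL : L = Ideal.span (Set.range g))
    (hJ : J = L.colon (I.map (C : MvPolynomial (Fin n) 𝕜 →+* MvPolynomial (Fin c × Fin r) (MvPolynomial (Fin n) 𝕜)))) :
    Ideal.lce p (I ^ c) = Ideal.lce p (L ^ c) ∧ Ideal.lce p (L ^ c) ≤ Ideal.lce p (J ^ c) := by
  subst hI hL hJ
  obtain rfl : g = fun i => ∑ j : Fin r, X (i, j) * C (f j) := funext hg
  rcases Nat.eq_zero_or_pos c with rfl | hc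
  · simp_rw [pow_zero, Ideal.one_eq_top]
    rw [Ideal.lce_top, Ideal.lce_top]
    exact ⟨rfl, le_rfl⟩
  have hne_top : Ideal.span (Set.range f) ≠ ⊤ := fun h => by
    rw [h, Ideal.idealHeight_top] at hht
    exact ENat.top_ne_natCast c hht
  have hne_bot : Ideal.span (Set.range f) ≠ ⊥ := fun h => by
    rw [h, Ideal.idealHeight_bot] at hht
    exact hc.ne (by exact_mod_cast hht)
  have : Nonempty (Fin c) := ⟨⟨0, hc⟩⟩
  refine ⟨by simpa using Ideal.lce_pow_generic (κ := Fin c) f hne_top,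
    Ideal.lce_le_lce (Ideal.pow_right_mono Ideal.le_colon c) fun htop => ?_⟩
  have hcolon := (Submodule.colon_eq_top_iff_subset _).1
    (top_le_iff.1 (htop.ge.trans (Ideal.pow_le_self hc.ne')))
  refine hne_bot (Ideal.span_eq_bot.2 ?_)
  rintro _ ⟨j, rfl⟩
  have hker : Ideal.span (Set.range fun i : Fin c => ∑ j : Fin r, X (i, j) * C (f j)) ≤
      RingHom.ker (eval (0 : Fin c × Fin r → MvPolynomial (Fin n) 𝕜)) := by
    rw [Ideal.span_le]
    rintro _ ⟨i, rfl⟩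
    simp
  simpa using hker (hcolon (Ideal.mem_map_of_mem C (Ideal.subset_span ⟨j, rfl⟩)))
end

section
/- Let R be a commutative ring of prime characteristic p, let S = R[u_1,…,u_m] be a polynomial ring over R, let 𝔫 be an ideal of R, let β_1,…,β_m ∈ R, and let 𝔪 := 𝔫S + (u_1 − β_1, …, u_m − β_m) ⊆ S. Then for every e ∈ ℕ, 𝔪^{[p^e]} ∩ R = 𝔫^{[p^e]}, i.e. the contraction of the Frobenius power of 𝔪 to R (along the inclusion R → S) equals the Frobenius power of 𝔫. -/
open Ideal MvPolynomial

set_option synthInstance.maxHeartbeats 1000000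
set_option maxHeartbeats 1000000

namespace Ideal

lemma frobPow_le_comap_frobPow {A B : Type*} [CommRing A] [CommRing B] (f : A →+* B) (q : ℕ)
    {I : Ideal A} {J : Ideal B} (h : I ≤ J.comap f) :
    I.frobPow q ≤ (J.frobPow q).comap f := by
  refine span_le.2 ?_
  rintro _ ⟨x, hx, rfl⟩
  change f (x ^ q) ∈ J.frobPow q
  rw [map_pow]
  exact subset_span ⟨f x, h hx, rfl⟩

end Ideal

/-- **Contraction of Frobenius powers.**
For `𝔪 = 𝔫S + (u_1 - β_1, …, u_m - β_m)` in `S = R[u_1,…,u_m]`, the contraction of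
`𝔪^{[p^e]}` to `R` equals `𝔫^{[p^e]}`. -/
theorem comap_frobPow_sup_sub
    {R : Type*} [CommRing R] {p : ℕ} (hp : p.Prime) [CharP R p]
    (m : ℕ) (𝔫 : Ideal R) (β : Fin m → R)
    (𝔪 : Ideal (MvPolynomial (Fin m) R))
    (h𝔪 : 𝔪 = 𝔫.map (C : R →+* MvPolynomial (Fin m) R) ⊔
      Ideal.span (Set.range fun j : Fin m => X j - C (β j))) :
    ∀ e : ℕ, (𝔪.frobPow (p ^ e)).comap (C : R →+* MvPolynomial (Fin m) R) =
      𝔫.frobPow (p ^ e) := by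
  intro e
  subst h𝔪
  apply le_antisymm
  · have hle : 𝔫.map C ⊔ Ideal.span (Set.range fun j : Fin m => X j - C (β j)) ≤
        𝔫.comap (eval β) := by
      refine sup_le (map_le_iff_le_comap.2 fun x hx => by simpa using hx) (span_le.2 ?_)
      rintro _ ⟨j, rfl⟩
      simp
    intro x hx
    simpa using frobPow_le_comap_frobPow (eval β) (p ^ e) hle hx
  · exact frobPow_le_comap_frobPow C (p ^ e) (map_le_iff_le_comap.1 le_sup_left)
end

section
/- Let R be a commutative ring of prime characteristic p, let S = R[u_1,…,u_r] be a polynomial ring over R, let f_1,…,f_r ∈ R, and set g := u_1 f_1 + ⋯ + u_r f_r ∈ S. Let b, i ∈ ℕ and let (γ_1,…,γ_r) be natural numbers with γ_1 + ⋯ + γ_r = b. Then the coefficient of the monomial u_1^{p^i γ_1} ⋯ u_r^{p^i γ_r} in g^{b·p^i} equals (b!/(γ_1!⋯γ_r!)) · f_1^{p^i γ_1} ⋯ f_r^{p^i γ_r}, where the multinomial coefficient is viewed in R via the canonical map ℕ → R. -/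
open MvPolynomial

set_option synthInstance.maxHeartbeats 1000000
set_option maxHeartbeats 1000000

/-- **Coefficient of a monomial in a power of `g = ∑ u_j f_j`.**
The coefficient of `u_1^{p^i γ_1} ⋯ u_r^{p^i γ_r}` in `g^{b p^i}` is
`(b!/(γ_1!⋯γ_r!)) f_1^{p^i γ_1} ⋯ f_r^{p^i γ_r}`. -/
theorem coeff_pow_generic_combination
    {R : Type*} [CommRing R] {p : ℕ} (hp : p.Prime) [CharP R p]
    {r : ℕ} (f : Fin r → R)
    (g : MvPolynomial (Fin r) R) (hg : g = ∑ j, X j * C (f j))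
    (b i : ℕ) (γ : Fin r → ℕ) (hγ : ∑ j, γ j = b) :
    MvPolynomial.coeff (Finsupp.equivFunOnFinite.symm fun j => p ^ i * γ j)
        (g ^ (b * p ^ i)) =
      (Nat.multinomial Finset.univ γ : R) * ∏ j, f j ^ (p ^ i * γ j) := by
  have : Fact p.Prime := ⟨hp⟩
  have hexp : (Finsupp.equivFunOnFinite.symm fun j => p ^ i * γ j) =
      p ^ i • Finsupp.equivFunOnFinite.symm γ := by
    ext j
    simp
  have hg' : g = ∑ j, f j • X j := by
    simp only [hg, smul_eq_C_mul, mul_comm]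
  have hsum : (Finsupp.equivFunOnFinite.symm γ).sum (fun _ m ↦ m) = b := by
    rw [Finsupp.sum_fintype _ _ (fun _ ↦ rfl), ← hγ]
    rfl
  rw [hexp, pow_mul, ← map_iterateFrobenius_expand p, coeff_map,
    coeff_expand_smul _ (pow_ne_zero i hp.ne_zero), hg',
    coeff_linearCombination_X_pow_of_fintype, if_pos hsum, map_mul, map_natCast,
    Finsupp.multinomial_eq_of_support_subset (Finset.subset_univ _),
    Finsupp.prod_fintype _ _ (fun _ ↦ pow_zero _), map_prod]
  simp [iterateFrobenius_def, ← pow_mul, mul_comm]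
end

section
/- Let 𝕜 be an algebraically closed field of characteristic p > 0, R = 𝕜[x_1,…,x_n], and S = R[u_1,…,u_m] a polynomial ring over R. Then for every ideal 𝔞 of R, fpt_S(𝔞S) = fpt_R(𝔞). -/
open Ideal MvPolynomial

set_option synthInstance.maxHeartbeats 1000000
set_option maxHeartbeats 1000000

theorem Ideal.map_frobPow_le {A B : Type*} [CommRing A] [CommRing B] (f : A →+* B) (q : ℕ)
    {I : Ideal A} {J : Ideal B} (h : I.map f ≤ J) : (I.frobPow q).map f ≤ J.frobPow q := by
  rw [Ideal.frobPow, Ideal.map_span, Ideal.span_le]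
  rintro _ ⟨_, ⟨x, hx, rfl⟩, rfl⟩
  exact Ideal.subset_span ⟨f x, h (Ideal.mem_map_of_mem f hx), by simp⟩

/-- The weak Nullstellensatz: over an algebraically closed field, every maximal ideal of an algebra
of finite type is the kernel of a rational point. -/
theorem Ideal.IsMaximal.exists_algHom_ker_eq {𝕜 A : Type*} [Field 𝕜] [IsAlgClosed 𝕜] [CommRing A]
    [Algebra 𝕜 A] [Algebra.FiniteType 𝕜 A] (M : Ideal A) (hM : M.IsMaximal) :
    ∃ π : A →ₐ[𝕜] 𝕜, RingHom.ker π = M := by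
  let := Ideal.Quotient.field M
  have : Module.Finite 𝕜 (A ⧸ M) := finite_of_finite_type_of_isJacobsonRing 𝕜 (A ⧸ M)
  have hb : Function.Bijective (Algebra.ofId 𝕜 (A ⧸ M)) :=
    IsAlgClosed.algebraMap_bijective_of_isIntegral
  refine ⟨(AlgEquiv.ofBijective _ hb).symm.toAlgHom.comp (Ideal.Quotient.mkₐ 𝕜 M), ?_⟩
  ext x
  simp [RingHom.mem_ker, Ideal.Quotient.eq_zero_iff_mem]

/-- A power of the extended ideal lies in a Frobenius power of some maximal ideal upstairs
iff the same holds downstairs. -/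
theorem exists_isMaximal_map_C_pow_le_frobPow_iff {𝕜 σ τ : Type*} [Field 𝕜] [IsAlgClosed 𝕜]
    [Finite σ] [Finite τ] (𝔞 : Ideal (MvPolynomial σ 𝕜)) (a q : ℕ) :
    (∃ M : Ideal (MvPolynomial τ (MvPolynomial σ 𝕜)), M.IsMaximal ∧
      𝔞.map (C : MvPolynomial σ 𝕜 →+* MvPolynomial τ (MvPolynomial σ 𝕜)) ^ a ≤ M.frobPow q) ↔
    ∃ m : Ideal (MvPolynomial σ 𝕜), m.IsMaximal ∧ 𝔞 ^ a ≤ m.frobPow q := by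
  constructor
  · rintro ⟨M, hM, h⟩
    have : Algebra.FiniteType 𝕜 (MvPolynomial τ (MvPolynomial σ 𝕜)) :=
      Algebra.FiniteType.trans (S := MvPolynomial σ 𝕜) inferInstance inferInstance
    obtain ⟨π, hπ⟩ := hM.exists_algHom_ker_eq (𝕜 := 𝕜)
    let ρ : MvPolynomial σ 𝕜 →+* 𝕜 := π.toRingHom.comp C
    have hρC (c : 𝕜) : ρ (C c) = c := π.commutes c
    let φ : MvPolynomial τ (MvPolynomial σ 𝕜) →+* MvPolynomial σ 𝕜 :=
      eval fun i => C (π (X i))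
    have hφ : ρ.comp φ = π := by
      refine MvPolynomial.ringHom_ext (fun r => ?_) fun i => ?_
      · simp [φ, ρ]
      · simp [φ, hρC]
    refine ⟨RingHom.ker ρ, RingHom.ker_isMaximal_of_surjective ρ fun c => ⟨C c, hρC c⟩, ?_⟩
    have hM' : M.map φ ≤ RingHom.ker ρ := by
      rw [Ideal.map_le_iff_le_comap, ← hπ]
      intro x hx
      exact (RingHom.congr_fun hφ x).trans hx
    have key := (Ideal.map_mono h).trans (Ideal.map_frobPow_le φ q hM')
    have hid : φ.comp C = RingHom.id _ :=
      RingHom.ext fun r => eval_C r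
    rwa [Ideal.map_pow, Ideal.map_map, hid, Ideal.map_id] at key
  · rintro ⟨m, hm, h⟩
    have hsurj : Function.Surjective
        (constantCoeff : MvPolynomial τ (MvPolynomial σ 𝕜) →+* MvPolynomial σ 𝕜) :=
      fun r => ⟨C r, constantCoeff_C τ r⟩
    refine ⟨m.comap constantCoeff, Ideal.comap_isMaximal_of_surjective _ hsurj, ?_⟩
    rw [← Ideal.map_pow]
    refine (Ideal.map_mono h).trans (Ideal.map_frobPow_le _ q ?_)
    rw [Ideal.map_le_iff_le_comap]
    intro x hx
    simpa using hx

/-- **`fpt` is unchanged under extension to a polynomial ring.**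
For `R = 𝕜[x_1,…,x_n]` and `S = R[u_1,…,u_m]` over an algebraically closed field `𝕜` of
characteristic `p > 0`, `fpt_S(𝔞S) = fpt_R(𝔞)` for every ideal `𝔞` of `R`. -/
theorem fpt_map_C
    {𝕜 : Type*} [Field 𝕜] [IsAlgClosed 𝕜] {p : ℕ} [Fact p.Prime] [CharP 𝕜 p]
    (n m : ℕ) (𝔞 : Ideal (MvPolynomial (Fin n) 𝕜)) :
    Ideal.fpt p (𝔞.map (C : MvPolynomial (Fin n) 𝕜 →+*
        MvPolynomial (Fin m) (MvPolynomial (Fin n) 𝕜))) = Ideal.fpt p 𝔞 := by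
  have key (a e : ℕ) := exists_isMaximal_map_C_pow_le_frobPow_iff (τ := Fin m) 𝔞 a (p ^ e)
  simp only [← not_iff_not (a := ∃ _, _), not_exists, not_and] at key
  simp only [Ideal.fpt, key]
end
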